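/- Fix p ∈ (0,1) and Z > 0, and for each n large enough that t_n := 1 − Z/√n ∈ (0,1), let B_n be a binomial random variable with parameters n and p. Then lim_{n → ∞} P( B_n / n < log(t_n·p + 1 − p)/log t_n ) = 1 − Φ( (Z/2)·√(p(1−p)) ), where Φ is the cumulative distribution function of the standard normal distribution. -/

import Mathlib

open Filter Finset

section

open MeasureTheory ProbabilityTheory

open scoped Topology

/-- The second-order Taylor expansion of `log (1 - x)` at `0`. -/
lemma tendsto_log_one_sub_add_self_div_sq :
    Tendsto (fun x : ℝ ↦ (Real.log (1 - x) + x) / x ^ 2) (𝓝[≠] 0) (𝓝 (-(1 / 2))) := by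
  have hbound : ∀ᶠ x : ℝ in 𝓝[≠] 0,
      ‖(Real.log (1 - x) + x) / x ^ 2 - -(1 / 2)‖ ≤ |x| / (1 - |x|) := by
    have hsmall : ∀ᶠ x : ℝ in 𝓝[≠] 0, |x| < 1 :=
      (continuous_abs.tendsto' (0 : ℝ) 0 abs_zero |>.eventually_lt_const one_pos).filter_mono
        nhdsWithin_le_nhds
    filter_upwards [hsmall, self_mem_nhdsWithin] with x hx hx0
    have hx0 : x ≠ 0 := hx0
    have h := Real.abs_log_sub_add_sum_range_le hx 2
    have hsum : ∑ i ∈ range 2, x ^ (i + 1) / ((i : ℝ) + 1) = x + x ^ 2 / 2 := by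
      norm_num [sum_range_succ]
    have hrw : (Real.log (1 - x) + x) / x ^ 2 - -(1 / 2)
        = (x + x ^ 2 / 2 + Real.log (1 - x)) / x ^ 2 := by
      field_simp
      ring
    rw [hsum] at h
    rw [hrw, Real.norm_eq_abs, abs_div, abs_of_nonneg (sq_nonneg x), div_le_iff₀ (by positivity)]
    refine h.trans_eq ?_
    rw [← sq_abs x]
    ring
  have hlim : Tendsto (fun x : ℝ ↦ |x| / (1 - |x|)) (𝓝[≠] 0) (𝓝 0) := by
    have : ContinuousAt (fun x : ℝ ↦ |x| / (1 - |x|)) 0 :=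
      ContinuousAt.div (by fun_prop) (by fun_prop) (by simp)
    simpa using this.tendsto.mono_left nhdsWithin_le_nhds
  exact tendsto_iff_norm_sub_tendsto_zero.2 <|
    squeeze_zero' (.of_forall fun _ ↦ norm_nonneg _) hbound hlim

lemma tendsto_log_one_sub_div_self :
    Tendsto (fun x : ℝ ↦ Real.log (1 - x) / x) (𝓝[≠] 0) (𝓝 (-1)) := by
  have hid : Tendsto (fun x : ℝ ↦ x) (𝓝[≠] 0) (𝓝 0) := nhdsWithin_le_nhds
  have h := (tendsto_log_one_sub_add_self_div_sq.mul hid).sub_const 1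
  rw [mul_zero, zero_sub] at h
  refine h.congr' ?_
  filter_upwards [self_mem_nhdsWithin] with x hx
  have hx : x ≠ 0 := hx
  field_simp
  ring

lemma tendsto_log_div_log_sub_div {p : ℝ} (hp : p ≠ 0) :
    Tendsto (fun x : ℝ ↦ (Real.log (1 - p * x) / Real.log (1 - x) - p) / x) (𝓝[≠] 0)
      (𝓝 (-(p * (1 - p) / 2))) := by
  have hmul : Tendsto (fun x : ℝ ↦ p * x) (𝓝[≠] 0) (𝓝[≠] 0) := by
    refine tendsto_nhdsWithin_iff.2 ⟨?_, ?_⟩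
    · exact ((continuous_const_mul p).tendsto' 0 0 (mul_zero p)).mono_left nhdsWithin_le_nhds
    · filter_upwards [self_mem_nhdsWithin] with x hx using mul_ne_zero hp hx
  have hnum := ((tendsto_log_one_sub_add_self_div_sq.comp hmul).const_mul (p ^ 2)).sub
    (tendsto_log_one_sub_add_self_div_sq.const_mul p)
  have h := hnum.div tendsto_log_one_sub_div_self (by norm_num)
  have hval : (p ^ 2 * -(1 / 2) - p * -(1 / 2)) / -1 = -(p * (1 - p) / 2) := by ring
  rw [hval] at h
  refine h.congr' ?_
  have hlog : ∀ᶠ x : ℝ in 𝓝[≠] 0, Real.log (1 - x) / x ≠ 0 :=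
    tendsto_log_one_sub_div_self.eventually_ne (by norm_num)
  filter_upwards [self_mem_nhdsWithin, hlog] with x hx hl
  have hx : x ≠ 0 := hx
  have hl : Real.log (1 - x) ≠ 0 := fun h0 ↦ hl (by simp [h0])
  simp only [Function.comp_apply, Pi.div_apply]
  field_simp
  ring

lemma tendsto_div_sqrt_nhdsNE_zero {Z : ℝ} (hZ : Z ≠ 0) :
    Tendsto (fun n : ℕ ↦ Z / √(n : ℝ)) atTop (𝓝[≠] 0) := by
  refine tendsto_nhdsWithin_iff.2 ⟨?_, ?_⟩
  · exact (Real.tendsto_sqrt_atTop.comp tendsto_natCast_atTop_atTop).const_div_atTop Z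
  · filter_upwards [eventually_gt_atTop 0] with n hn
    have : (0 : ℝ) < n := by exact_mod_cast hn
    exact div_ne_zero hZ (by positivity)

lemma tendsto_sqrt_mul_threshold_sub {p Z : ℝ} (hp : p ≠ 0) (hZ : Z ≠ 0) :
    Tendsto (fun n : ℕ ↦ √(n : ℝ) * (Real.log ((1 - Z / √(n : ℝ)) * p + 1 - p)
      / Real.log (1 - Z / √(n : ℝ)) - p)) atTop (𝓝 (-(Z * (p * (1 - p)) / 2))) := by
  have h := ((tendsto_log_div_log_sub_div hp).comp (tendsto_div_sqrt_nhdsNE_zero hZ)).const_mul Z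
  have hval : Z * -(p * (1 - p) / 2) = -(Z * (p * (1 - p)) / 2) := by ring
  rw [hval] at h
  refine h.congr fun n ↦ ?_
  have harg : (1 - Z / √(n : ℝ)) * p + 1 - p = 1 - p * (Z / √(n : ℝ)) := by ring
  simp only [Function.comp_apply, harg]
  field_simp

/-- The law of a standardized binomial random variable, translated by `-c`. -/
noncomputable def shiftedBinomial (p : unitInterval) (σ c : ℝ) (n : ℕ) : Measure ℝ :=
  (binomial n p).map fun k : ℕ ↦ (k - n * p : ℝ) / (σ * √(n : ℝ)) - c

instance (p : unitInterval) (σ c : ℝ) (n : ℕ) : IsProbabilityMeasure (shiftedBinomial p σ c n) :=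
  Measure.isProbabilityMeasure_map Measurable.of_discrete.aemeasurable

lemma charFun_shiftedBinomial (p : unitInterval) (σ c : ℝ) (n : ℕ) (s : ℝ) :
    charFun (shiftedBinomial p σ c n) s = Complex.exp (-(s * c * Complex.I)) *
      charFun ((bernoulliMeasure (1 : ℝ) 0 p).map fun x ↦ (x - p) / σ) ((√(n : ℝ))⁻¹ * s) ^ n := by
  rw [charFun_apply_real, charFun_apply_real, shiftedBinomial,
    integral_map Measurable.of_discrete.aemeasurable (by fun_prop),
    integral_map (by fun_prop) (by fun_prop),
    integral_binomial, integral_bernoulliMeasure, add_pow, mul_sum,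
    ← Nat.range_succ_eq_Iic]
  refine sum_congr rfl fun k hk ↦ ?_
  have hkn : k ≤ n := Nat.lt_succ_iff.1 (mem_range.1 hk)
  simp only [Complex.real_smul, mul_pow, ← Complex.exp_nat_mul]
  have hexp : Complex.exp (s * ((k - n * p : ℝ) / (σ * √(n : ℝ)) - c : ℝ) * Complex.I)
      = Complex.exp (-(s * c * Complex.I))
        * (Complex.exp (k * (((√(n : ℝ))⁻¹ * s : ℝ) * ((1 - p) / σ : ℝ) * Complex.I))
        * Complex.exp ((n - k : ℕ) * (((√(n : ℝ))⁻¹ * s : ℝ) * ((0 - p) / σ : ℝ)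
          * Complex.I))) := by
    rw [← Complex.exp_add, ← Complex.exp_add]
    congr 1
    push_cast [hkn]
    ring
  rw [hexp]
  push_cast
  ring

/-- The de Moivre–Laplace theorem, in the form of weak convergence, with a converging shift. -/
lemma tendsto_shiftedBinomial {p : unitInterval} (hp0 : (0 : ℝ) < p) (hp1 : (p : ℝ) < 1)
    {c : ℕ → ℝ} {c₀ : ℝ} (hc : Tendsto c atTop (𝓝 c₀)) :
    @Tendsto ℕ (ProbabilityMeasure ℝ)
      (fun n ↦ ⟨shiftedBinomial p √(p * (1 - p)) (c n) n, inferInstance⟩) atTop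
      (𝓝 ⟨gaussianReal (-c₀) 1, inferInstance⟩) := by
  refine ProbabilityMeasure.tendsto_iff_tendsto_charFun.2 fun s ↦ ?_
  have hvar : (0 : ℝ) < p * (1 - p) := mul_pos hp0 (sub_pos.2 hp1)
  have hq : (1 - p : ℝ) ≠ 0 := (sub_pos.2 hp1).ne'
  have hσ : √(p * (1 - p) : ℝ) ≠ 0 := (Real.sqrt_pos.2 hvar).ne'
  simp only [ProbabilityMeasure.coe_mk, charFun_shiftedBinomial, charFun_gaussianReal]
  have hclt := tendsto_charFun_inv_sqrt_mul_pow (P := bernoulliMeasure (1 : ℝ) 0 p)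
    (X := fun x ↦ (x - p) / √(p * (1 - p) : ℝ)) (by fun_prop)
    (by
      rw [integral_bernoulliMeasure]
      simp only [smul_eq_mul]
      ring)
    (by
      rw [integral_bernoulliMeasure]
      simp only [Pi.pow_apply, smul_eq_mul, div_pow, Real.sq_sqrt hvar.le]
      field_simp
      ring) s
  have hshift : Tendsto (fun n ↦ Complex.exp (-(s * c n * Complex.I))) atTop
      (𝓝 (Complex.exp (-(s * c₀ * Complex.I)))) := by
    have hcont : Continuous fun x : ℝ ↦ Complex.exp (-(s * x * Complex.I)) := by fun_prop
    exact (hcont.tendsto c₀).comp hc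
  convert! hshift.mul hclt using 2
  rw [← Complex.exp_add]
  congr 1
  push_cast
  ring

lemma shiftedBinomial_real_Iio_zero (p : unitInterval) {σ : ℝ} (hσ : 0 < σ) {n : ℕ} (hn : 0 < n)
    (a : ℝ) :
    (shiftedBinomial p σ (√(n : ℝ) * (a - p) / σ) n).real (Set.Iio 0)
      = ∑ k ∈ (range (n + 1)).filter (fun k : ℕ ↦ (k : ℝ) / n < a),
        (n.choose k : ℝ) * (p : ℝ) ^ k * (1 - p) ^ (n - k) := by
  have hn' : (0 : ℝ) < n := by exact_mod_cast hn
  have hset : (fun k : ℕ ↦ (k - n * p : ℝ) / (σ * √(n : ℝ)) - √(n : ℝ) * (a - p) / σ) ⁻¹' Set.Iio 0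
      = {k : ℕ | (k : ℝ) / n < a} := by
    ext k
    have hsq : √(n : ℝ) * √(n : ℝ) = n := Real.mul_self_sqrt hn'.le
    have hrw : √(n : ℝ) * (a - p) / σ = n * (a - p) / (σ * √(n : ℝ)) := by
      rw [div_eq_div_iff hσ.ne' (by positivity)]
      linear_combination σ * (a - p) * hsq
    rw [Set.mem_preimage, Set.mem_Iio, sub_neg, hrw,
      div_lt_div_iff_of_pos_right (by positivity), Set.mem_ofPred_eq, div_lt_iff₀ hn']
    constructor <;> intro h <;> linarith
  rw [shiftedBinomial, map_measureReal_apply .of_discrete measurableSet_Iio, hset,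
    ← integral_indicator_one (.of_discrete), integral_binomial, ← Nat.range_succ_eq_Iic,
    sum_filter]
  refine sum_congr rfl fun k _ ↦ ?_
  simp [Set.indicator_apply]

lemma gaussianReal_real_Iio_zero (c : ℝ) :
    (gaussianReal c 1).real (Set.Iio 0)
      = 1 - ∫ x in Set.Iic c, Real.exp (-x ^ 2 / 2) / √(2 * Real.pi) := by
  have hmap : gaussianReal c 1 = (gaussianReal 0 1).map (fun x ↦ c - x) := by
    rw [gaussianReal_map_const_sub, sub_zero]
  have hpre : (fun x ↦ c - x) ⁻¹' Set.Iio 0 = (Set.Iic c)ᶜ := by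
    ext x
    simp
  rw [hmap, map_measureReal_apply (by fun_prop) measurableSet_Iio, hpre,
    probReal_compl_eq_one_sub measurableSet_Iic, measureReal_def,
    gaussianReal_apply_eq_integral 0 one_ne_zero, ENNReal.toReal_ofReal
      (integral_nonneg fun x ↦ gaussianPDFReal_nonneg 0 1 x)]
  congr 1
  refine setIntegral_congr_fun measurableSet_Iic fun x _ ↦ ?_
  simp [gaussianPDFReal, div_eq_inv_mul]

end

/-- Lemma 1: if `B_n ~ Binomial(n, p)` and `t_n = 1 − Z/√n`, then
`P(B_n/n < log(t_n·p + 1 − p)/log t_n) → 1 − Φ((Z/2)·√(p(1−p)))`,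
where `Φ` is the standard normal cdf.  The probability is written
explicitly via the binomial probability mass function. -/
theorem stmt_10 (p Z : ℝ) (hp : p ∈ Set.Ioo (0 : ℝ) 1) (hZ : 0 < Z)
    (t : ℕ → ℝ) (ht : ∀ n, t n = 1 - Z / Real.sqrt n)
    (P : ℕ → ℝ)
    (hP : ∀ n, P n = ∑ k ∈ (Finset.range (n + 1)).filter
        (fun k : ℕ => (k : ℝ) / n
          < Real.log (t n * p + 1 - p) / Real.log (t n)),
        (n.choose k : ℝ) * p ^ k * (1 - p) ^ (n - k))
    (Φ : ℝ → ℝ)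
    (hΦ : ∀ z, Φ z = ∫ x in Set.Iic z,
        Real.exp (-x ^ 2 / 2) / Real.sqrt (2 * Real.pi)) :
    Tendsto P atTop
      (nhds (1 - Φ (Z / 2 * Real.sqrt (p * (1 - p))))) := by
  obtain ⟨hp0, hp1⟩ := hp
  have hvar : 0 < p * (1 - p) := mul_pos hp0 (sub_pos.2 hp1)
  have hσ : 0 < √(p * (1 - p)) := Real.sqrt_pos.2 hvar
  let q : unitInterval := ⟨p, hp0.le, hp1.le⟩
  have hthr := (tendsto_sqrt_mul_threshold_sub hp0.ne' hZ.ne').div_const √(p * (1 - p))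
  have hval : -(Z * (p * (1 - p)) / 2) / √(p * (1 - p)) = -(Z / 2 * √(p * (1 - p))) := by
    rw [div_eq_iff hσ.ne', neg_mul, mul_assoc, Real.mul_self_sqrt hvar.le]
    ring
  rw [hval] at hthr
  have hweak := tendsto_shiftedBinomial (p := q) hp0 hp1 hthr
  have hlim := MeasureTheory.ProbabilityMeasure.tendsto_measure_of_null_frontier_of_tendsto'
    hweak (E := Set.Iio 0) (by
      have := ProbabilityTheory.nullSingletonClass_gaussianReal
        (μ := Z / 2 * √(p * (1 - p))) one_ne_zero
      simp)
  have hreal := (ENNReal.tendsto_toReal (MeasureTheory.measure_ne_top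
    (ProbabilityTheory.gaussianReal _ 1) _)).comp hlim
  have hΦc := gaussianReal_real_Iio_zero (Z / 2 * √(p * (1 - p)))
  rw [← hΦ, MeasureTheory.measureReal_def] at hΦc
  rw [← hΦc]
  simp only [MeasureTheory.ProbabilityMeasure.coe_mk, neg_neg] at hreal
  refine hreal.congr' ?_
  filter_upwards [eventually_gt_atTop 0] with n hn
  rw [hP, ht]
  exact shiftedBinomial_real_Iio_zero q hσ hn _
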